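/- For each n, let Θ_n = [−n, n] ⊂ ℝ, let Π_n be the normalized restriction of the standard normal distribution N(0,1) to [−n,n], and let Q_n = N(0, n^{−1}) be an independence proposal. Let M_n be the law on Θ_n^ℕ₀ of the Metropolis–Hastings chain with target Π_n, proposal Q_n (independent of the current state), started at 0, with the standard acceptance ratio, and let e_m be the empirical distribution map. Then there exists c > 0 such that for every fixed m, liminf_{n→∞} R_m(M_n, Π_n) ≥ c, where R_m(M_n, Π_n) = ∫ w(e_m(θ(0),…,θ(m−1)), Π_n) M_n(dθ_∞). Consequently there exists m_n → ∞ with liminf_{n→∞} R_{m_n}(M_n, Π_n) > 0, so the sequence of Metropolis–Hastings procedures is not consistent to (Π_n). -/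

import Mathlib

open MeasureTheory ProbabilityTheory Filter Topology Matrix ENNReal

/-- The class `BL₁(Θ)` of Borel measurable functions `f : Θ → ℝ` with
`|f s - f t| ≤ d(s,t)` for all `s, t`. -/
def BLone (Θ : Type*) [MeasurableSpace Θ] [PseudoMetricSpace Θ] : Set (Θ → ℝ) :=
  {f | Measurable f ∧ ∀ s t : Θ, |f s - f t| ≤ dist s t}

/-- The bounded Lipschitz distance `w(μ,ν) = sup_{f ∈ BL₁} |∫ f dμ - ∫ f dν|`. -/
noncomputable def blDist {Θ : Type*} [MeasurableSpace Θ] [PseudoMetricSpace Θ]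
    (μ ν : Measure Θ) : ℝ :=
  ⨆ f ∈ BLone Θ, |∫ x, f x ∂μ - ∫ x, f x ∂ν|

/-- The empirical distribution `e_m(θ(0),…,θ(m-1)) = (1/m) ∑_{i<m} δ_{θ(i)}`. -/
noncomputable def emp {Θ : Type*} [MeasurableSpace Θ] (θ : ℕ → Θ) (m : ℕ) : Measure Θ :=
  (m : ℝ≥0∞)⁻¹ • ∑ i ∈ Finset.range m, Measure.dirac (θ i)

/-- The risk `R_m(M,Π) = ∫ w(e_m(θ(0),…,θ(m-1)), Π) M(dθ_∞)`. -/
noncomputable def risk {Θ : Type*} [MeasurableSpace Θ] [PseudoMetricSpace Θ]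
    (M : Measure (ℕ → Θ)) (target : Measure Θ) (m : ℕ) : ℝ :=
  ∫ θ, blDist (emp θ m) target ∂M

/-- Iterated integral `∫_{A_1} K(x,dy_1) ∫_{A_2} K(y_1,dy_2) ⋯` describing the
finite dimensional distributions of a Markov measure. -/
noncomputable def markovCyl {Θ : Type*} [MeasurableSpace Θ] (K : Θ → Measure Θ) :
    List (Set Θ) → Θ → ℝ≥0∞
  | [], _ => 1
  | A :: rest, x => ∫⁻ y in A, markovCyl K rest y ∂(K x)

/-- `M` is the Markov measure on `Θ^{ℕ₀}` generated by the initial distribution `μ` and the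
transition kernel `K`, characterized through its finite dimensional cylinder probabilities. -/
def IsMarkovMeasure {Θ : Type*} [MeasurableSpace Θ] (M : Measure (ℕ → Θ)) (μ : Measure Θ)
    (K : Θ → Measure Θ) : Prop :=
  ∀ (A₀ : Set Θ) (As : List (Set Θ)), MeasurableSet A₀ → (∀ B ∈ As, MeasurableSet B) →
    M {θ | θ 0 ∈ A₀ ∧ ∀ (i : ℕ) (h : i < As.length), θ (i + 1) ∈ As.get ⟨i, h⟩} =
      ∫⁻ x in A₀, markovCyl K As x ∂μ

/-- The standard normal density `φ`. -/
noncomputable def stdNormalDensity (z : ℝ) : ℝ :=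
  Real.exp (-z ^ 2 / 2) / Real.sqrt (2 * Real.pi)

/-- The density of `N(0, v)` (variance `v`). -/
noncomputable def gaussDensity (v z : ℝ) : ℝ :=
  Real.exp (-z ^ 2 / (2 * v)) / Real.sqrt (2 * Real.pi * v)

/-- The standard normal distribution `N(0,1)` on `ℝ`. -/
noncomputable def stdNormal : Measure ℝ :=
  volume.withDensity fun z => ENNReal.ofReal (stdNormalDensity z)

/-- The target `Π_n`: the normalized restriction of `N(0,1)` to `[-n, n]`. -/
noncomputable def mhTarget (n : ℕ) : Measure ℝ :=
  (stdNormal (Set.Icc (-(n : ℝ)) n))⁻¹ • stdNormal.restrict (Set.Icc (-(n : ℝ)) n)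

/-- The independence proposal `Q_n = N(0, n⁻¹)`. -/
noncomputable def mhProposal (n : ℕ) : Measure ℝ :=
  volume.withDensity fun z => ENNReal.ofReal (gaussDensity (n : ℝ)⁻¹ z)

/-- The Metropolis–Hastings ratio `r(x,y) = (π(y) q(x)) / (π(x) q(y))` for the target `Π_n`
(with unnormalized density `1_{[-n,n]} φ`) and proposal density `q`. -/
noncomputable def mhRatio (n : ℕ) (x y : ℝ) : ℝ :=
  ((Set.Icc (-(n : ℝ)) (n : ℝ)).indicator stdNormalDensity y * gaussDensity (n : ℝ)⁻¹ x) /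
    ((Set.Icc (-(n : ℝ)) (n : ℝ)).indicator stdNormalDensity x * gaussDensity (n : ℝ)⁻¹ y)

/-- The standard acceptance probability `α(x,y) = min{1, r(x,y)}`. -/
noncomputable def mhAlpha (n : ℕ) (x y : ℝ) : ℝ := min 1 (mhRatio n x y)

/-- The Metropolis–Hastings transition kernel
`K(x,dy) = α(x,y) Q(dy) + (1 − ∫ α(x,z) Q(dz)) δ_x(dy)`. -/
noncomputable def mhKernel (n : ℕ) (x : ℝ) : Measure ℝ :=
  (mhProposal n).withDensity (fun y => ENNReal.ofReal (mhAlpha n x y)) +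
    (1 - ∫⁻ y, ENNReal.ofReal (mhAlpha n x y) ∂(mhProposal n)) • Measure.dirac x

section BoundedLipschitz

lemma integral_emp (f : ℝ → ℝ) (θ : ℕ → ℝ) (m : ℕ) :
    ∫ x, f x ∂emp θ m = (∑ i ∈ Finset.range m, f (θ i)) / m := by
  have hf : ∀ i ∈ Finset.range m, Integrable f (Measure.dirac (θ i)) := fun i _ =>
    integrable_dirac (by simp)
  rw [emp, integral_smul_measure, integral_finsetSum_measure hf]
  simp [div_eq_inv_mul]

lemma integrable_of_mem_BLone {f : ℝ → ℝ} (hf : f ∈ BLone ℝ) {ν : Measure ℝ} [IsFiniteMeasure ν]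
    (hν : Integrable (fun x => |x|) ν) : Integrable f ν := by
  refine ((integrable_const |f 0|).add hν).mono' hf.1.aestronglyMeasurable (ae_of_all _ fun x => ?_)
  have h := hf.2 x 0
  rw [Real.dist_eq, sub_zero] at h
  have := abs_add_le (f x - f 0) (f 0)
  simp only [sub_add_cancel] at this
  simp only [Pi.add_apply, Real.norm_eq_abs]
  linarith

lemma abs_integral_emp_sub_integral_le {f : ℝ → ℝ} (hf : f ∈ BLone ℝ) {ν : Measure ℝ}
    [IsProbabilityMeasure ν] (hν : Integrable (fun x => |x|) ν) (θ : ℕ → ℝ) {m : ℕ} (hm : 1 ≤ m) :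
    |∫ x, f x ∂emp θ m - ∫ x, f x ∂ν| ≤
      (∫ x, |x| ∂ν) + (∑ i ∈ Finset.range m, |θ i|) / m := by
  have hm' : (m : ℝ) ≠ 0 := by positivity
  have hd : ∀ x, |f x - f 0| ≤ |x| := fun x => by simpa using hf.2 x 0
  have h₁ : ∫ x, f x ∂emp θ m - f 0 = (∑ i ∈ Finset.range m, (f (θ i) - f 0)) / m := by
    rw [integral_emp, Finset.sum_sub_distrib]
    simp only [Finset.sum_const, Finset.card_range, nsmul_eq_mul]
    field_simp
  have h₂ : ∫ x, f x ∂ν - f 0 = ∫ x, (f x - f 0) ∂ν := by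
    rw [integral_sub (integrable_of_mem_BLone hf hν) (integrable_const _)]
    simp
  have h₃ : |∫ x, f x ∂emp θ m - f 0| ≤ (∑ i ∈ Finset.range m, |θ i|) / m := by
    rw [h₁, abs_div, Nat.abs_cast]
    gcongr
    exact (Finset.abs_sum_le_sum_abs _ _).trans (Finset.sum_le_sum fun i _ => hd _)
  have h₄ : |∫ x, f x ∂ν - f 0| ≤ ∫ x, |x| ∂ν := by
    rw [h₂]
    exact norm_integral_le_of_norm_le (f := fun x => f x - f 0) hν (ae_of_all _ hd)
  rw [abs_le] at h₃ h₄ ⊢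
  constructor <;> linarith [h₃.1, h₃.2, h₄.1, h₄.2]

variable {ν : Measure ℝ} [IsProbabilityMeasure ν]

lemma bddAbove_range_BLone (hν : Integrable (fun x => |x|) ν) (θ : ℕ → ℝ) {m : ℕ} (hm : 1 ≤ m) :
    BddAbove (Set.range fun f : BLone ℝ => |∫ x, f.1 x ∂emp θ m - ∫ x, f.1 x ∂ν|) :=
  ⟨_, by rintro _ ⟨f, rfl⟩; exact abs_integral_emp_sub_integral_le f.2 hν θ hm⟩

lemma blDist_emp_eq_iSup_subtype (hν : Integrable (fun x => |x|) ν) (θ : ℕ → ℝ) {m : ℕ}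
    (hm : 1 ≤ m) :
    blDist (emp θ m) ν = ⨆ f : BLone ℝ, |∫ x, f.1 x ∂emp θ m - ∫ x, f.1 x ∂ν| :=
  (ciSup_subtype (bddAbove_range_BLone hν θ hm)
    (Real.sSup_empty.trans_le (Real.iSup_nonneg fun _ => abs_nonneg _))).symm

lemma blDist_emp_le (hν : Integrable (fun x => |x|) ν) (θ : ℕ → ℝ) {m : ℕ} (hm : 1 ≤ m) :
    blDist (emp θ m) ν ≤ (∫ x, |x| ∂ν) + (∑ i ∈ Finset.range m, |θ i|) / m := by
  rw [blDist_emp_eq_iSup_subtype hν θ hm]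
  have : Nonempty (BLone ℝ) := ⟨⟨fun _ => 0, measurable_const, fun s t => by simp⟩⟩
  exact ciSup_le fun f => abs_integral_emp_sub_integral_le f.2 hν θ hm

lemma le_blDist_emp (hν : Integrable (fun x => |x|) ν) (θ : ℕ → ℝ) {m : ℕ} (hm : 1 ≤ m) :
    (∫ x, |x| ∂ν) - (∑ i ∈ Finset.range m, |θ i|) / m ≤ blDist (emp θ m) ν := by
  have habs : (fun x : ℝ => |x|) ∈ BLone ℝ :=
    ⟨measurable_id.abs, fun s t => abs_abs_sub_abs_le_abs_sub s t⟩
  rw [blDist_emp_eq_iSup_subtype hν θ hm]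
  refine le_trans ?_ (le_ciSup (bddAbove_range_BLone hν θ hm) ⟨_, habs⟩)
  simp only [integral_emp]
  exact (le_abs_self _).trans_eq (abs_sub_comm _ _)

lemma blDist_nonneg (μ ν : Measure ℝ) : 0 ≤ blDist μ ν :=
  Real.iSup_nonneg fun _ => Real.iSup_nonneg fun _ => abs_nonneg _

lemma measurable_blDist_emp (hν : Integrable (fun x => |x|) ν) {m : ℕ} (hm : 1 ≤ m) :
    Measurable fun θ : ℕ → ℝ => blDist (emp θ m) ν := by
  simp only [blDist_emp_eq_iSup_subtype hν _ hm]
  refine (lowerSemicontinuous_ciSup (fun θ => bddAbove_range_BLone hν θ hm)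
    fun f => Continuous.lowerSemicontinuous ?_).measurable
  have hf : Continuous f.1 := (LipschitzWith.of_dist_le_mul (K := 1) fun s t => by
    simpa [Real.dist_eq] using f.2.2 s t).continuous
  simp only [integral_emp]
  fun_prop

end BoundedLipschitz

section MarkovCylinders

lemma pow_le_markovCyl {Θ : Type*} [MeasurableSpace Θ] {K : Θ → Measure Θ} {B : Set Θ}
    (hB : MeasurableSet B) {q : ℝ≥0∞} (hq : ∀ x ∈ B, q ≤ K x B) (k : ℕ) :
    ∀ x ∈ B, q ^ k ≤ markovCyl K (List.replicate k B) x := by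
  induction k with
  | zero => simp [markovCyl]
  | succ k ih =>
    intro x hx
    rw [List.replicate_succ, markovCyl]
    calc q ^ (k + 1) ≤ q ^ k * K x B := by rw [pow_succ]; gcongr; exact hq x hx
      _ = ∫⁻ _ in B, q ^ k ∂K x := by simp
      _ ≤ _ := setLIntegral_mono' hB ih

lemma IsMarkovMeasure.pow_le_measure_forall_mem {Θ : Type*} [MeasurableSpace Θ]
    [MeasurableSingletonClass Θ] {M : Measure (ℕ → Θ)} {K : Θ → Measure Θ} {x : Θ}
    (hM : IsMarkovMeasure M (Measure.dirac x) K) {B : Set Θ} (hB : MeasurableSet B) (hx : x ∈ B)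
    {q : ℝ≥0∞} (hq : ∀ x ∈ B, q ≤ K x B) (k : ℕ) :
    q ^ k ≤ M {θ | ∀ i < k + 1, θ i ∈ B} := by
  classical
  have h := hM B (List.replicate k B) hB (fun C hC => (List.eq_of_mem_replicate hC) ▸ hB)
  rw [setLIntegral_dirac, if_pos hx] at h
  refine (pow_le_markovCyl hB hq k x hx).trans (h.ge.trans (measure_mono ?_))
  rintro θ ⟨h0, hs⟩ (_ | i) hi
  · exact h0
  · simpa using hs i (by simpa using hi)

end MarkovCylinders

section Gaussian

lemma mhProposal_eq {n : ℕ} (hn : 1 ≤ n) : mhProposal n = gaussianReal 0 (n : NNReal)⁻¹ := by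
  rw [gaussianReal_of_var_ne_zero _ (by positivity), mhProposal]
  congr 1
  ext z
  simp [gaussianPDF, gaussianPDFReal, gaussDensity, div_eq_inv_mul]

lemma stdNormal_eq : stdNormal = gaussianReal 0 1 := by
  rw [gaussianReal_of_var_ne_zero _ one_ne_zero, stdNormal]
  congr 1
  ext z
  simp [gaussianPDF, gaussianPDFReal, stdNormalDensity, div_eq_inv_mul]

lemma mhProposal_real_compl_le {n : ℕ} (hn : 1 ≤ n) {ε : ℝ} (hε : 0 ≤ ε) :
    (mhProposal n).real (Set.Icc (-ε) ε)ᶜ ≤ 2 * Real.exp (-(n * ε ^ 2 / 2)) := by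
  have hn' : (0 : ℝ) < n := by positivity
  rw [mhProposal_eq hn]
  set μ := gaussianReal 0 (n : NNReal)⁻¹
  have h₁ := measure_ge_le_exp_mul_mgf (X := id) (μ := μ) ε (t := n * ε) (by positivity)
    (integrable_exp_mul_gaussianReal _)
  have h₂ := measure_le_le_exp_mul_mgf (X := id) (μ := μ) (-ε) (t := -(n * ε))
    (by simp only [Left.neg_nonpos_iff]; positivity) (integrable_exp_mul_gaussianReal _)
  rw [mgf_id_gaussianReal, ← Real.exp_add] at h₁ h₂
  have hsub : (Set.Icc (-ε) ε)ᶜ ⊆ {x | ε ≤ id x} ∪ {x | id x ≤ -ε} := by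
    intro x hx
    simp only [Set.mem_compl_iff, Set.mem_Icc, not_and_or, not_le] at hx
    exact hx.symm.imp le_of_lt le_of_lt
  refine (measureReal_mono hsub).trans ((measureReal_union_le _ _).trans ?_)
  rw [two_mul]
  refine add_le_add (h₁.trans_eq ?_) (h₂.trans_eq ?_) <;>
  · congr 1
    push_cast
    field_simp
    ring

end Gaussian

section Kernel

lemma one_sub_le_mhKernel (n : ℕ) {B : Set ℝ} (hB : MeasurableSet B) {x : ℝ} (hx : x ∈ B) :
    1 - ∫⁻ y in Bᶜ, ENNReal.ofReal (mhAlpha n x y) ∂mhProposal n ≤ mhKernel n x B := by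
  rw [mhKernel, Measure.add_apply, withDensity_apply _ hB, Measure.smul_apply,
    Measure.dirac_apply_of_mem hx, smul_eq_mul, mul_one, tsub_le_iff_right, add_right_comm,
    lintegral_add_compl _ hB]
  exact le_add_tsub

lemma ofReal_one_sub_le_mhKernel {n : ℕ} (hn : 1 ≤ n) {ε : ℝ} {x : ℝ}
    (hx : x ∈ Set.Icc (-ε) ε) :
    ENNReal.ofReal (1 - 2 * Real.exp (-(n * ε ^ 2 / 2))) ≤ mhKernel n x (Set.Icc (-ε) ε) := by
  have hε : 0 ≤ ε := by linarith [hx.1, hx.2]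
  have : IsProbabilityMeasure (mhProposal n) := mhProposal_eq hn ▸ inferInstance
  refine le_trans ?_ (one_sub_le_mhKernel n measurableSet_Icc hx)
  rw [ENNReal.ofReal_sub _ (by positivity), ENNReal.ofReal_one]
  gcongr
  calc _ ≤ ∫⁻ _ in (Set.Icc (-ε) ε)ᶜ, 1 ∂mhProposal n := by
        gcongr with y
        exact ENNReal.ofReal_le_one.2 (min_le_left _ _)
    _ = mhProposal n (Set.Icc (-ε) ε)ᶜ := by simp
    _ ≤ _ := by
        rw [← ofReal_measureReal]
        exact ENNReal.ofReal_le_ofReal (mhProposal_real_compl_le hn hε)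

lemma one_le_mhKernel_support (n : ℕ) {x : ℝ} (hx : x ∈ Set.Icc (-(n : ℝ)) n) :
    1 ≤ mhKernel n x (Set.Icc (-(n : ℝ)) n) := by
  refine le_trans (le_of_eq ?_) (one_sub_le_mhKernel n measurableSet_Icc hx)
  rw [setLIntegral_congr_fun (g := fun _ => 0) measurableSet_Icc.compl]
  · simp
  · intro y hy
    simp [mhAlpha, mhRatio, Set.indicator_of_notMem hy]

end Kernel

section Target

lemma integrable_abs_stdNormal : Integrable (fun x => |x|) stdNormal := by
  rw [stdNormal_eq]
  exact ((memLp_id_gaussianReal 1).integrable (by simp)).abs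

lemma stdNormal_Icc_pos {a b : ℝ} (h : a < b) : 0 < stdNormal (Set.Icc a b) := by
  rw [stdNormal_eq, pos_iff_ne_zero]
  intro h0
  have := gaussianReal_absolutelyContinuous' 0 one_ne_zero h0
  simp [h.not_ge] at this

instance : IsProbabilityMeasure stdNormal := stdNormal_eq ▸ inferInstance

lemma isProbabilityMeasure_mhTarget {n : ℕ} (hn : 1 ≤ n) :
    IsProbabilityMeasure (mhTarget n) := by
  have hn' : (1 : ℝ) ≤ n := by exact_mod_cast hn
  constructor
  simp only [mhTarget, Measure.smul_apply, Measure.restrict_apply_univ, smul_eq_mul]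
  exact ENNReal.inv_mul_cancel (stdNormal_Icc_pos (by linarith)).ne' (measure_ne_top _ _)

lemma integrable_abs_mhTarget {n : ℕ} (hn : 1 ≤ n) :
    Integrable (fun x => |x|) (mhTarget n) := by
  have hn' : (1 : ℝ) ≤ n := by exact_mod_cast hn
  exact integrable_abs_stdNormal.restrict.smul_measure
    (ENNReal.inv_ne_top.2 (stdNormal_Icc_pos (by linarith)).ne')

lemma integral_abs_mhTarget (n : ℕ) :
    ∫ x, |x| ∂mhTarget n = (stdNormal.real (Set.Icc (-(n : ℝ)) n))⁻¹ *
      ∫ x in Set.Icc (-(n : ℝ)) n, |x| ∂stdNormal := by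
  rw [mhTarget, integral_smul_measure, ENNReal.toReal_inv, smul_eq_mul, measureReal_def]

lemma setIntegral_abs_stdNormal_pos : 0 < ∫ x in Set.Icc (-1 : ℝ) 1, |x| ∂stdNormal := by
  rw [setIntegral_pos_iff_support_of_nonneg_ae (ae_of_all _ fun x => abs_nonneg x)
    integrable_abs_stdNormal.integrableOn]
  refine (stdNormal_Icc_pos (a := 1 / 2) (b := 1) (by norm_num)).trans_le (measure_mono ?_)
  rintro x ⟨h₁, h₂⟩
  have : 0 < x := by linarith
  exact ⟨by simpa using this.ne', by linarith, h₂⟩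

lemma le_integral_abs_mhTarget {n : ℕ} (hn : 1 ≤ n) :
    ∫ x in Set.Icc (-1 : ℝ) 1, |x| ∂stdNormal ≤ ∫ x, |x| ∂mhTarget n := by
  have hn' : (1 : ℝ) ≤ n := by exact_mod_cast hn
  have hp : 0 < stdNormal.real (Set.Icc (-(n : ℝ)) n) :=
    ENNReal.toReal_pos (stdNormal_Icc_pos (by linarith)).ne' (measure_ne_top _ _)
  rw [integral_abs_mhTarget]
  calc _ ≤ ∫ x in Set.Icc (-(n : ℝ)) n, |x| ∂stdNormal :=
        setIntegral_mono_set integrable_abs_stdNormal.integrableOn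
          (ae_of_all _ fun x => abs_nonneg x)
          (Set.Icc_subset_Icc (by linarith) hn').eventuallyLE
    _ ≤ _ := le_mul_of_one_le_left (integral_nonneg fun x => abs_nonneg x)
        ((one_le_inv₀ hp).2 measureReal_le_one)

lemma integral_abs_mhTarget_le {n : ℕ} (hn : 1 ≤ n) :
    ∫ x, |x| ∂mhTarget n ≤
      (stdNormal.real (Set.Icc (-1 : ℝ) 1))⁻¹ * ∫ x, |x| ∂stdNormal := by
  have hn' : (1 : ℝ) ≤ n := by exact_mod_cast hn
  have hp : 0 < stdNormal.real (Set.Icc (-1 : ℝ) 1) :=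
    ENNReal.toReal_pos (stdNormal_Icc_pos (by norm_num)).ne' (measure_ne_top _ _)
  rw [integral_abs_mhTarget]
  refine mul_le_mul (inv_anti₀ hp (measureReal_mono (Set.Icc_subset_Icc (by linarith) hn')))
    (setIntegral_le_integral integrable_abs_stdNormal (ae_of_all _ fun x => abs_nonneg x))
    (integral_nonneg fun x => abs_nonneg x) (by positivity)

end Target

section Risk

variable {n m : ℕ} {M : Measure (ℕ → ℝ)} [IsProbabilityMeasure M]

lemma ae_forall_mem_support (hM : IsMarkovMeasure M (Measure.dirac 0) (mhKernel n)) (hm : 1 ≤ m) :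
    ∀ᵐ θ ∂M, ∀ i < m, θ i ∈ Set.Icc (-(n : ℝ)) n := by
  obtain ⟨k, rfl⟩ := Nat.exists_eq_add_of_le' hm
  have h := hM.pow_le_measure_forall_mem measurableSet_Icc (by simp)
    (fun x hx => one_le_mhKernel_support n hx) k
  rw [one_pow] at h
  rw [ae_iff, ← Set.compl_ofPred, prob_compl_eq_zero_iff]
  · exact le_antisymm prob_le_one h
  · measurability

lemma measureReal_not_forall_mem_le (hM : IsMarkovMeasure M (Measure.dirac 0) (mhKernel n))
    (hn : 1 ≤ n) (hm : 1 ≤ m) (hmn : m ≤ n) {ε : ℝ} (hε : 0 ≤ ε) :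
    M.real {θ | ∀ i < m, θ i ∈ Set.Icc (-ε) ε}ᶜ ≤ n * (2 * Real.exp (-(n * ε ^ 2 / 2))) := by
  obtain ⟨k, rfl⟩ := Nat.exists_eq_add_of_le' hm
  set δ := 2 * Real.exp (-(n * ε ^ 2 / 2))
  have hδ : 0 ≤ δ := by positivity
  by_cases hδ1 : δ ≤ 1
  · have h := hM.pow_le_measure_forall_mem measurableSet_Icc (B := Set.Icc (-ε) ε) (by simp [hε])
      (fun x hx => ofReal_one_sub_le_mhKernel hn hx) k
    rw [← ENNReal.ofReal_pow (by linarith), ← ofReal_measureReal,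
      ENNReal.ofReal_le_ofReal_iff measureReal_nonneg] at h
    have hb := one_add_mul_le_pow (show (-2 : ℝ) ≤ -δ by linarith) k
    have hk : (k : ℝ) * δ ≤ n * δ := by gcongr; omega
    rw [probReal_compl_eq_one_sub (by measurability)]
    rw [← sub_eq_add_neg] at hb
    linarith
  · have hn' : (1 : ℝ) ≤ n := by exact_mod_cast hn
    exact measureReal_le_one.trans (by nlinarith)

lemma average_abs_le {θ : ℕ → ℝ} {r : ℝ} (hm : 1 ≤ m) (hθ : ∀ i < m, θ i ∈ Set.Icc (-r) r) :
    (∑ i ∈ Finset.range m, |θ i|) / m ≤ r := by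
  rw [div_le_iff₀ (by positivity), mul_comm, ← nsmul_eq_mul]
  simpa using Finset.sum_le_card_nsmul (Finset.range m) (fun i => |θ i|) r
    fun i hi => abs_le.2 (hθ i (Finset.mem_range.1 hi))

lemma integrable_blDist_emp (hM : IsMarkovMeasure M (Measure.dirac 0) (mhKernel n))
    (hn : 1 ≤ n) (hm : 1 ≤ m) :
    Integrable (fun θ => blDist (emp θ m) (mhTarget n)) M := by
  have := isProbabilityMeasure_mhTarget hn
  have hν := integrable_abs_mhTarget hn
  refine (integrable_const ((∫ x, |x| ∂mhTarget n) + n)).mono'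
    (measurable_blDist_emp hν hm).aestronglyMeasurable ?_
  filter_upwards [ae_forall_mem_support hM hm] with θ hθ
  rw [Real.norm_of_nonneg (blDist_nonneg _ _)]
  exact (blDist_emp_le hν θ hm).trans (by gcongr; exact average_abs_le hm hθ)

lemma le_risk (hM : IsMarkovMeasure M (Measure.dirac 0) (mhKernel n))
    (hn : 1 ≤ n) (hm : 1 ≤ m) (hmn : m ≤ n) {ε : ℝ} (hε : 0 ≤ ε)
    (hε' : ε ≤ ∫ x, |x| ∂mhTarget n) :
    ((∫ x, |x| ∂mhTarget n) - ε) * (1 - n * (2 * Real.exp (-(n * ε ^ 2 / 2)))) ≤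
      risk M (mhTarget n) m := by
  have := isProbabilityMeasure_mhTarget hn
  have hν := integrable_abs_mhTarget hn
  set a := ∫ x, |x| ∂mhTarget n
  set G : Set (ℕ → ℝ) := {θ | ∀ i < m, θ i ∈ Set.Icc (-ε) ε}
  have hG : MeasurableSet G := by measurability
  have hle := measureReal_not_forall_mem_le hM hn hm hmn hε
  rw [probReal_compl_eq_one_sub hG] at hle
  calc _ ≤ (a - ε) * M.real G := by gcongr; linarith
    _ = ∫ θ, G.indicator (fun _ => a - ε) θ ∂M := by
        rw [integral_indicator_const _ hG, smul_eq_mul, mul_comm]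
    _ ≤ _ := by
        refine integral_mono ((integrable_const _).indicator hG)
          (integrable_blDist_emp hM hn hm) fun θ => ?_
        by_cases hθ : θ ∈ G
        · rw [Set.indicator_of_mem hθ]
          linarith [le_blDist_emp hν θ hm, average_abs_le hm hθ]
        · rw [Set.indicator_of_notMem hθ]
          exact blDist_nonneg _ _

lemma risk_le (hM : IsMarkovMeasure M (Measure.dirac 0) (mhKernel n))
    (hn : 1 ≤ n) (hm : 1 ≤ m) (hmn : m ≤ n) {ε : ℝ} (hε : 0 ≤ ε) :
    risk M (mhTarget n) m ≤
      (∫ x, |x| ∂mhTarget n) + ε + n * (n * (2 * Real.exp (-(n * ε ^ 2 / 2)))) := by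
  have := isProbabilityMeasure_mhTarget hn
  have hν := integrable_abs_mhTarget hn
  set a := ∫ x, |x| ∂mhTarget n
  set G : Set (ℕ → ℝ) := {θ | ∀ i < m, θ i ∈ Set.Icc (-ε) ε}
  have hG : MeasurableSet G := by measurability
  have hle := measureReal_not_forall_mem_le hM hn hm hmn hε
  calc _ ≤ ∫ θ, (a + ε + Gᶜ.indicator (fun _ => (n : ℝ)) θ) ∂M := by
        refine integral_mono_ae (integrable_blDist_emp hM hn hm)
          ((integrable_const _).add ((integrable_const _).indicator hG.compl)) ?_
        filter_upwards [ae_forall_mem_support hM hm] with θ hs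
        by_cases hθ : θ ∈ G
        · rw [Set.indicator_of_notMem (by simpa using hθ)]
          linarith [blDist_emp_le hν θ hm, average_abs_le hm hθ]
        · rw [Set.indicator_of_mem (by simpa using hθ)]
          linarith [blDist_emp_le hν θ hm, average_abs_le hm hs]
    _ = a + ε + n * M.real Gᶜ := by
        rw [integral_add (integrable_const _) ((integrable_const _).indicator hG.compl),
          integral_indicator_const _ hG.compl]
        simp [mul_comm]
    _ ≤ _ := by gcongr

end Risk

lemma tendsto_pow_mul_exp_neg_mul {b : ℝ} (hb : 0 < b) (k : ℕ) :
    Tendsto (fun n : ℕ => (n : ℝ) ^ k * Real.exp (-(n * b))) atTop (𝓝 0) := by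
  have h := (Real.tendsto_pow_mul_exp_neg_atTop_nhds_zero k).comp
    (tendsto_natCast_atTop_atTop.atTop_mul_const hb)
  have h' := h.mul_const ((b ^ k)⁻¹)
  rw [zero_mul] at h'
  refine h'.congr fun n => ?_
  simp only [Function.comp, mul_pow]
  field_simp

lemma exists_risk_bounds (M : ℕ → Measure (ℕ → ℝ)) [∀ n, IsProbabilityMeasure (M n)]
    (hM : ∀ n, IsMarkovMeasure (M n) (Measure.dirac 0) (mhKernel n)) :
    ∃ c > (0 : ℝ), ∃ C : ℝ, ∀ᶠ n in atTop, ∀ m, 1 ≤ m → m ≤ n →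
      c ≤ risk (M n) (mhTarget n) m ∧ risk (M n) (mhTarget n) m ≤ C := by
  have hc := setIntegral_abs_stdNormal_pos
  set c := ∫ x in Set.Icc (-1 : ℝ) 1, |x| ∂stdNormal
  have hb : 0 < (c / 2) ^ 2 / 2 := by positivity
  refine ⟨c / 4, by positivity,
    (stdNormal.real (Set.Icc (-1 : ℝ) 1))⁻¹ * (∫ x, |x| ∂stdNormal) + c / 2 + 1, ?_⟩
  filter_upwards [eventually_ge_atTop 1,
    (tendsto_pow_mul_exp_neg_mul hb 1).eventually_le_const (show (0 : ℝ) < 1 / 4 by norm_num),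
    (tendsto_pow_mul_exp_neg_mul hb 2).eventually_le_const (show (0 : ℝ) < 1 / 2 by norm_num)]
    with n hn h₁ h₂ m hm hmn
  have hlow := le_integral_abs_mhTarget hn
  have hup := integral_abs_mhTarget_le hn
  rw [← mul_div_assoc] at h₁ h₂
  constructor
  · refine le_trans ?_ (le_risk (hM n) hn hm hmn (ε := c / 2) (by positivity) (by linarith))
    calc c / 4 = (c - c / 2) * (1 / 2) := by ring
      _ ≤ _ := by gcongr <;> linarith
  · refine (risk_le (hM n) hn hm hmn (ε := c / 2) (by positivity)).trans ?_
    linarith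

/-- For the Metropolis–Hastings chains `M_n` with target the normalized
restriction `Π_n` of `N(0,1)` to `[-n,n]`, independence proposal `N(0,n⁻¹)`, started at `0`,
there exists `c > 0` with `liminf_n R_m(M_n,Π_n) ≥ c` for every fixed `m`; consequently there
is `m_n → ∞` with `liminf_n R_{m_n}(M_n,Π_n) > 0`, so the procedures are not consistent. -/
theorem metropolis_hastings_not_consistent
    (M : ℕ → Measure (ℕ → ℝ)) [∀ n, IsProbabilityMeasure (M n)]
    (hM : ∀ n, IsMarkovMeasure (M n) (Measure.dirac 0) (mhKernel n)) :
    ∃ c > (0 : ℝ),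
      (∀ m : ℕ, 1 ≤ m → c ≤ atTop.liminf fun n => risk (M n) (mhTarget n) m) ∧
      ∃ mseq : ℕ → ℕ, Tendsto mseq atTop atTop ∧
        0 < atTop.liminf fun n => risk (M n) (mhTarget n) (mseq n) := by
  obtain ⟨c, hc, C, hcC⟩ := exists_risk_bounds M hM
  have key : ∀ mseq : ℕ → ℕ, (∀ᶠ n in atTop, 1 ≤ mseq n ∧ mseq n ≤ n) →
      c ≤ atTop.liminf fun n => risk (M n) (mhTarget n) (mseq n) := fun mseq hm => by
    refine le_liminf_of_le (isCoboundedUnder_ge_of_eventually_le _ (x := C) ?_) ?_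
    · filter_upwards [hcC, hm] with n h hn using (h _ hn.1 hn.2).2
    · filter_upwards [hcC, hm] with n h hn using (h _ hn.1 hn.2).1
  refine ⟨c, hc, fun m hm => key (fun _ => m) ?_, id, tendsto_id, hc.trans_le (key id ?_)⟩
  · filter_upwards [eventually_ge_atTop m] with n hn using ⟨hm, hn⟩
  · filter_upwards [eventually_ge_atTop 1] with n hn using ⟨hn, le_rfl⟩
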